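/- Let β(n) denote the minimal expected value E[τ_n] over all online selection policies π = (τ_1, …, τ_n), where τ_1 < τ_2 < ⋯ < τ_n are stopping times adapted to the natural filtration of an i.i.d. sequence X_1, X_2, … of uniform [0,1] random variables with X_{τ_1} < X_{τ_2} < ⋯ < X_{τ_n}. Then for all positive integers m and n one has β(m·n) ≤ min(m²·β(n), n²·β(m)). Equivalently, for the sequence defined by β(1) = 1 and β(n+1) = inf_{0<t<1}[1/t + (β(n)/t)·log(1/(1−t))], one has β(m·n) ≤ m²·β(n) for all m, n ≥ 1. -/

import Mathlib

open Set

/-- `g x t = 1/t + (x/t)·log(1/(1−t))`. -/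
noncomputable def g (x t : ℝ) : ℝ := 1 / t + (x / t) * Real.log (1 / (1 - t))

/-- `G x = inf_{0<t<1} g x t`. -/
noncomputable def G (x : ℝ) : ℝ := sInf ((fun t => g x t) '' Set.Ioo (0 : ℝ) 1)

/-- The sequence `β` with `β 1 = 1` and `β (n+1) = G (β n)` for `n ≥ 1`
(the value at `0` is irrelevant). -/
noncomputable def beta : ℕ → ℝ
  | 0 => 0
  | 1 => 1
  | n + 2 => G (beta (n + 1))

/-- The function `w² - 1 - 2 log w`; if its value at `w > 1` is `1 / x`, then `G x = w² x`. -/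
noncomputable def gapFun (w : ℝ) : ℝ := w ^ 2 - 1 - 2 * Real.log w

lemma two_mul_log_le_sub_inv {w : ℝ} (hw : 1 ≤ w) : 2 * Real.log w ≤ w - w⁻¹ := by
  have h := Real.self_le_sinh_iff.2 (Real.log_nonneg hw)
  rw [Real.sinh_log (by linarith)] at h
  linarith

lemma gapFun_div_sq_antitoneOn : AntitoneOn (fun w => gapFun w / (w - 1) ^ 2) (Ioi 1) := by
  have hd : ∀ w ∈ Ioi (1 : ℝ), HasDerivAt (fun w => gapFun w / (w - 1) ^ 2)
      (((2 * w - 2 * w⁻¹) * (w - 1) ^ 2 - gapFun w * (2 * (w - 1))) / ((w - 1) ^ 2) ^ 2) w := by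
    intro w hw
    have hw : 1 < w := hw
    have h1 : HasDerivAt gapFun (2 * w - 2 * w⁻¹) w := by
      refine ((((hasDerivAt_id w).pow 2).sub_const 1).sub
        ((Real.hasDerivAt_log (by linarith : w ≠ 0)).const_mul 2)).congr_deriv ?_
      simp
    have h2 : HasDerivAt (fun w : ℝ => (w - 1) ^ 2) (2 * (w - 1)) w := by
      refine (((hasDerivAt_id w).sub_const 1).pow 2).congr_deriv ?_
      simp
    exact h1.div h2 (pow_ne_zero 2 (by linarith))
  refine antitoneOn_of_deriv_nonpos (convex_Ioi 1)
    (fun w hw => (hd w hw).continuousAt.continuousWithinAt)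
    (fun w hw => (hd w (interior_subset hw)).differentiableAt.differentiableWithinAt) ?_
  intro w hw
  have hw' : w ∈ Ioi (1 : ℝ) := interior_subset hw
  rw [(hd w hw').deriv]
  have hw1 : 1 < w := hw'
  have hlog := two_mul_log_le_sub_inv hw1.le
  refine div_nonpos_of_nonpos_of_nonneg ?_ (by positivity)
  have hinv : w * w⁻¹ = 1 := mul_inv_cancel₀ (by linarith)
  have key : (2 * w - 2 * w⁻¹) * (w - 1) ^ 2 - gapFun w * (2 * (w - 1))
      = 2 * (w - 1) * (2 * Real.log w - (w - w⁻¹)) := by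
    unfold gapFun
    linear_combination (-2 * (w - 1)) * hinv
  rw [key]
  exact mul_nonpos_of_nonneg_of_nonpos (by linarith) (by linarith)

lemma g_nonneg {x t : ℝ} (hx : 0 ≤ x) (ht : t ∈ Ioo (0 : ℝ) 1) : 0 ≤ g x t := by
  obtain ⟨h0, h1⟩ := ht
  have hlog : 0 ≤ Real.log (1 / (1 - t)) :=
    Real.log_nonneg (by rw [le_div_iff₀ (by linarith)]; linarith)
  unfold g
  positivity

lemma G_le_g {x t : ℝ} (hx : 0 ≤ x) (ht : t ∈ Ioo (0 : ℝ) 1) : G x ≤ g x t :=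
  csInf_le ⟨0, by rintro _ ⟨s, hs, rfl⟩; exact g_nonneg hx hs⟩ ⟨t, ht, rfl⟩

lemma le_G {x c : ℝ} (h : ∀ t ∈ Ioo (0 : ℝ) 1, c ≤ g x t) : c ≤ G x := by
  refine le_csInf ⟨_, 1 / 2, by norm_num, rfl⟩ ?_
  rintro _ ⟨t, ht, rfl⟩
  exact h t ht

lemma G_mono {x y : ℝ} (hx : 0 ≤ x) (hxy : x ≤ y) : G x ≤ G y := by
  refine le_G fun t ht => (G_le_g hx ht).trans ?_
  obtain ⟨h0, h1⟩ := ht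
  have hlog : 0 ≤ Real.log (1 / (1 - t)) :=
    Real.log_nonneg (by rw [le_div_iff₀ (by linarith)]; linarith)
  unfold g
  gcongr

lemma G_le_sq_mul {x w : ℝ} (hx : 0 ≤ x) (hw : 1 < w) (h : 1 ≤ x * gapFun w) :
    G x ≤ w ^ 2 * x := by
  have hw2 : 1 < w ^ 2 := by nlinarith
  have ht : 1 - (w ^ 2)⁻¹ ∈ Ioo (0 : ℝ) 1 :=
    ⟨by linarith [inv_lt_one_of_one_lt₀ hw2], by linarith [inv_pos.2 (by linarith : 0 < w ^ 2)]⟩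
  refine (G_le_g hx ht).trans ?_
  have hlog : Real.log (1 / (1 - (1 - (w ^ 2)⁻¹))) = 2 * Real.log w := by
    simp
  unfold g
  rw [hlog, div_mul_eq_mul_div, ← add_div, div_le_iff₀ ht.1]
  have hinv : w ^ 2 * (w ^ 2)⁻¹ = 1 := mul_inv_cancel₀ (by linarith)
  unfold gapFun at h
  linear_combination h + x * hinv

lemma exists_one_lt_mul_gapFun_eq_one {x : ℝ} (hx : 0 < x) :
    ∃ w, 1 < w ∧ x * gapFun w = 1 := by
  have hb : 1 ≤ 2 + x⁻¹ := by linarith [inv_pos.2 hx]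
  have hc : ContinuousOn (fun w => x * gapFun w) (Icc 1 (2 + x⁻¹)) := by
    unfold gapFun
    refine continuousOn_const.mul (((continuousOn_id.pow 2).sub continuousOn_const).sub
      (continuousOn_const.mul (Real.continuousOn_log.mono ?_)))
    intro w hw
    simpa using (by linarith [hw.1] : w ≠ 0)
  have hupper : 1 ≤ x * gapFun (2 + x⁻¹) := by
    have hl := Real.log_le_sub_one_of_pos (by linarith : 0 < 2 + x⁻¹)
    have hg : x⁻¹ ≤ gapFun (2 + x⁻¹) := by
      unfold gapFun
      nlinarith [inv_pos.2 hx]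
    calc (1 : ℝ) = x * x⁻¹ := (mul_inv_cancel₀ hx.ne').symm
      _ ≤ _ := by gcongr
  have hlower : x * gapFun 1 = 0 := by simp [gapFun]
  obtain ⟨w, hw, hxw⟩ := intermediate_value_Icc hb hc
    (show (1 : ℝ) ∈ Icc (x * gapFun 1) (x * gapFun (2 + x⁻¹)) from ⟨by linarith, hupper⟩)
  refine ⟨w, lt_of_le_of_ne hw.1 ?_, hxw⟩
  rintro rfl
  simp only [hlower] at hxw
  linarith

lemma sq_mul_le_G {x w : ℝ} (hx : 0 < x) (hw : 1 < w) (h : x * gapFun w = 1) :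
    w ^ 2 * x ≤ G x := by
  refine le_G fun t ht => ?_
  obtain ⟨h0, h1⟩ := ht
  have h1t : 0 < 1 - t := by linarith
  have hw2 : 0 < w ^ 2 := by positivity
  have hl := Real.log_le_sub_one_of_pos (mul_pos hw2 h1t)
  rw [Real.log_mul hw2.ne' h1t.ne', Real.log_pow] at hl
  push_cast at hl
  unfold g
  rw [div_mul_eq_mul_div, ← add_div, le_div_iff₀ h0, one_div, Real.log_inv]
  unfold gapFun at h
  linear_combination h + x * hl

/-- The increment of `√x` under `G` is nonincreasing in `x`. -/
lemma G_sq_le_add_sq {u v w : ℝ} (hu : 0 < u) (huv : u ≤ v) (hw : 1 < w)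
    (h : u ^ 2 * gapFun w = 1) : G (v ^ 2) ≤ (v + u * (w - 1)) ^ 2 := by
  have hv : 0 < v := by linarith
  have hw1 : 0 < w - 1 := by linarith
  have hδ : 0 < u * (w - 1) / v := by positivity
  have hle : 1 + u * (w - 1) / v ≤ w := by
    have : u * (w - 1) / v ≤ w - 1 := by
      rw [div_le_iff₀ hv]
      nlinarith
    linarith
  have hanti := gapFun_div_sq_antitoneOn (show 1 + u * (w - 1) / v ∈ Ioi (1 : ℝ) by
    simpa using hδ) hw hle
  have hgap : 1 ≤ v ^ 2 * gapFun (1 + u * (w - 1) / v) := by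
    simp only [add_sub_cancel_left] at hanti
    rw [le_div_iff₀ (by positivity)] at hanti
    calc (1 : ℝ) = u ^ 2 * gapFun w := h.symm
      _ = v ^ 2 * (gapFun w / (w - 1) ^ 2 * (u * (w - 1) / v) ^ 2) := by field_simp
      _ ≤ _ := by gcongr
  refine (G_le_sq_mul (sq_nonneg v) (by linarith) hgap).trans_eq ?_
  field_simp

lemma G_sq_le_add_one_sq {v : ℝ} (hv : 0 < v) : G (v ^ 2) ≤ (v + 1) ^ 2 := by
  have hgap : 1 ≤ v ^ 2 * gapFun (1 + 1 / v) := by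
    have hl := Real.log_le_sub_one_of_pos (show 0 < 1 + 1 / v by positivity)
    have hg : (1 / v) ^ 2 ≤ gapFun (1 + 1 / v) := by
      unfold gapFun
      linarith
    calc (1 : ℝ) = v ^ 2 * (1 / v) ^ 2 := by field_simp
      _ ≤ _ := by gcongr
  have h1 : 1 < 1 + 1 / v := by simpa using hv
  refine (G_le_sq_mul (sq_nonneg v) h1 hgap).trans_eq ?_
  field_simp

lemma beta_succ {n : ℕ} (hn : 1 ≤ n) : beta (n + 1) = G (beta n) := by
  obtain ⟨k, rfl⟩ := Nat.exists_eq_add_of_le' hn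
  rfl

lemma beta_pos {n : ℕ} (hn : 1 ≤ n) : 0 < beta n := by
  induction n, hn using Nat.le_induction with
  | base => simp [beta]
  | succ n hn ih =>
    obtain ⟨w, hw, h⟩ := exists_one_lt_mul_gapFun_eq_one ih
    rw [beta_succ hn]
    exact lt_of_lt_of_le (by positivity) (sq_mul_le_G ih hw h)

lemma beta_le_sq {n : ℕ} (hn : 1 ≤ n) : beta n ≤ (n : ℝ) ^ 2 := by
  induction n, hn using Nat.le_induction with
  | base => simp [beta]
  | succ n hn ih =>
    rw [beta_succ hn]
    push_cast
    exact (G_mono (beta_pos hn).le ih).trans (G_sq_le_add_one_sq (by exact_mod_cast hn))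

lemma beta_mul_le {m n : ℕ} (hm : 1 ≤ m) (hn : 1 ≤ n) :
    beta (m * n) ≤ (m : ℝ) ^ 2 * beta n := by
  induction n, hn using Nat.le_induction with
  | base => simpa [beta] using beta_le_sq hm
  | succ n hn ih =>
    have hx := beta_pos hn
    obtain ⟨w, hw, h⟩ := exists_one_lt_mul_gapFun_eq_one hx
    have hu : 0 < √(beta n) := Real.sqrt_pos.2 hx
    have hsq : √(beta n) ^ 2 = beta n := Real.sq_sqrt hx.le
    set u := √(beta n)
    have hmR : (1 : ℝ) ≤ m := by exact_mod_cast hm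
    have hw1 : 0 < w - 1 := by linarith
    have hstep : ∀ j : ℕ, beta (m * n + j) ≤ (m * u + j * (u * (w - 1))) ^ 2 := by
      intro j
      induction j with
      | zero => simpa [mul_pow, hsq] using ih
      | succ j hj =>
        have hmn : 1 ≤ m * n + j := le_add_right (Nat.mul_pos hm hn)
        have hle : u ≤ m * u + j * (u * (w - 1)) := by
          have h1 : 1 * u ≤ m * u := by gcongr
          have h2 : 0 ≤ j * (u * (w - 1)) := by positivity
          linarith
        rw [← add_assoc, beta_succ hmn]
        refine (G_mono (beta_pos hmn).le hj).trans
          ((G_sq_le_add_sq hu hle hw (by rw [hsq, h])).trans_eq ?_)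
        push_cast
        ring
    calc beta (m * (n + 1)) ≤ (m * u + m * (u * (w - 1))) ^ 2 := hstep m
      _ = m ^ 2 * (w ^ 2 * beta n) := by rw [← hsq]; ring
      _ ≤ m ^ 2 * beta (n + 1) := by
        rw [beta_succ hn]
        gcongr
        exact sq_mul_le_G hx hw h

/-- Blocking inequality: `β(m·n) ≤ min(m²·β(n), n²·β(m))` for all positive integers
`m, n`, where `β` is given by `β(1) = 1` and
`β(n+1) = inf_{0<t<1}[1/t + (β(n)/t)·log(1/(1−t))] = G (β n)`. -/
theorem blocking_inequality :
    ∀ m n : ℕ, 1 ≤ m → 1 ≤ n →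
      beta (m * n) ≤ min ((m : ℝ) ^ 2 * beta n) ((n : ℝ) ^ 2 * beta m) := by
  intro m n hm hn
  refine le_min (beta_mul_le hm hn) ?_
  rw [mul_comm m n]
  exact beta_mul_le hn hm
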